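/- arXiv:2208.09173 — 2 statements merged into one kernel-verified Lean document; each statement's English description precedes it below -/
import Mathlib

section
/- Let m, l, k₀, k₁, k₂ be non-negative integers and let G be the presented group ⟨x, y, γ ∣ (γ^(2^m) x^(2^l))^(2^k₀), y^(2^k₁), (x y x⁻¹ y⁻¹)^(2^k₂)⟩. Then the abelianization of G is an infinite cyclic group generated by the image of γ if and only if k₀ = k₁ = l = 0. -/
/-- A homomorphism to a commutative group killing an element whose class generates the
abelianization is trivial. -/
theorem eq_one_of_zpowers_abelianization_eq_top {G A : Type*} [Group G] [CommGroup A] {g : G}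
    (hg : Subgroup.zpowers (Abelianization.of g) = ⊤) (f : G →* A) (hf : f g = 1) (h : G) :
    f h = 1 := by
  have hmem : Abelianization.of h ∈ Subgroup.zpowers (Abelianization.of g) :=
    hg ▸ Subgroup.mem_top _
  obtain ⟨n, hn⟩ := Subgroup.mem_zpowers_iff.mp hmem
  have := congrArg (Abelianization.lift f) hn
  rw [map_zpow, Abelianization.lift_apply_of, Abelianization.lift_apply_of, hf, one_zpow] at this
  exact this.symm

/-- The abelianization of a presented group is generated by the classes of the generators. -/
theorem abelianization_presentedGroup_eq_top {α : Type*} {rels : Set (FreeGroup α)}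
    {H : Subgroup (Abelianization (PresentedGroup rels))}
    (hH : ∀ a, Abelianization.of (PresentedGroup.of a : PresentedGroup rels) ∈ H) : H = ⊤ := by
  have hle : (⊤ : Subgroup (PresentedGroup rels)) ≤ H.comap Abelianization.of := by
    rw [← PresentedGroup.closure_range_of, Subgroup.closure_le]
    rintro _ ⟨a, rfl⟩
    exact hH a
  refine eq_top_iff.mpr fun z _ => ?_
  obtain ⟨g, rfl⟩ := QuotientGroup.mk_surjective z
  exact hle (Subgroup.mem_top g)

/-- A group generated by an element that a homomorphism sends to the generator of `ℤ` is
infinite cyclic. -/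
theorem nonempty_mulEquiv_int_of_zpowers_eq_top {A : Type*} [Group A] {a : A}
    (ha : Subgroup.zpowers a = ⊤) (f : A →* Multiplicative ℤ)
    (hf : f a = Multiplicative.ofAdd 1) : Nonempty (A ≃* Multiplicative ℤ) := by
  have hpow (n : ℤ) : f (a ^ n) = Multiplicative.ofAdd n := by
    rw [map_zpow, hf, ← ofAdd_zsmul, smul_eq_mul, mul_one]
  refine ⟨MulEquiv.ofBijective f ⟨(injective_iff_map_eq_one f).mpr fun b hb => ?_,
    fun n => ⟨a ^ n.toAdd, hpow _⟩⟩⟩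
  have hmem : b ∈ Subgroup.zpowers a := ha ▸ Subgroup.mem_top b
  obtain ⟨n, rfl⟩ := Subgroup.mem_zpowers_iff.mp hmem
  rw [hpow, ofAdd_eq_one] at hb
  rw [hb, zpow_zero]

/-- In `ℤ/2`, written multiplicatively, every `2 ^ k`-th power with `k ≠ 0` is trivial. -/
theorem multiplicative_zmod_two_pow_two_pow {k : ℕ} (hk : k ≠ 0) (a : Multiplicative (ZMod 2)) :
    a ^ 2 ^ k = 1 := by
  have hsq : a ^ 2 = 1 := by
    revert a
    decide
  obtain ⟨j, rfl⟩ := Nat.exists_eq_succ_of_ne_zero hk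
  rw [pow_succ', pow_mul, hsq, one_pow]

/-- Lemma 6.3(1), homological computation: the abelianization of
⟨x, y, γ ∣ (γ^(2^m) x^(2^l))^(2^k₀), y^(2^k₁), (x y x⁻¹ y⁻¹)^(2^k₂)⟩ is infinite
cyclic generated by the image of γ iff k₀ = k₁ = l = 0.  (x = 0, y = 1, γ = 2.) -/
theorem stmt8 (m l k₀ k₁ k₂ : ℕ) :
    ∀ (rels : Set (FreeGroup (Fin 3))),
      rels = {((FreeGroup.of 2) ^ (2 ^ m) * (FreeGroup.of 0) ^ (2 ^ l)) ^ (2 ^ k₀),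
               (FreeGroup.of 1) ^ (2 ^ k₁),
               (FreeGroup.of 0 * FreeGroup.of 1 * (FreeGroup.of 0)⁻¹ * (FreeGroup.of 1)⁻¹) ^ (2 ^ k₂)} →
      ((Nonempty (Abelianization (PresentedGroup rels) ≃* Multiplicative ℤ) ∧
        Subgroup.zpowers (Abelianization.of (PresentedGroup.of ((2 : Fin 3)) : PresentedGroup rels)) = ⊤) ↔
        (k₀ = 0 ∧ k₁ = 0 ∧ l = 0)) := by
  intro rels hrels
  constructor
  · rintro ⟨-, hγ⟩
    have key (v : Fin 3 → Multiplicative (ZMod 2)) (hv : v 2 = 1)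
        (hx : (v 0 ^ 2 ^ l) ^ 2 ^ k₀ = 1) (hy : v 1 ^ 2 ^ k₁ = 1) (i : Fin 3) : v i = 1 := by
      have hrel : ∀ r ∈ rels, FreeGroup.lift v r = 1 := by
        rw [hrels]
        rintro r (rfl | rfl | rfl)
        · simp [hv, hx]
        · simp [hy]
        · simp
      have := eq_one_of_zpowers_abelianization_eq_top hγ (PresentedGroup.toGroup hrel)
        (by rw [PresentedGroup.toGroup.of, hv]) (PresentedGroup.of i)
      rwa [PresentedGroup.toGroup.of] at this
    have hne : Multiplicative.ofAdd (1 : ZMod 2) ≠ 1 := by decide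
    refine ⟨?_, ?_, ?_⟩ <;> by_contra hk
    · exact hne (key ![.ofAdd 1, 1, 1] rfl
        (multiplicative_zmod_two_pow_two_pow hk _) (one_pow _) 0)
    · exact hne (key ![1, .ofAdd 1, 1] rfl (by simp)
        (multiplicative_zmod_two_pow_two_pow hk _) 1)
    · refine hne (key ![.ofAdd 1, 1, 1] rfl ?_ (one_pow _) 0)
      rw [multiplicative_zmod_two_pow_two_pow hk, one_pow]
  · rintro ⟨rfl, rfl, rfl⟩
    have hxγ : (PresentedGroup.of 2 : PresentedGroup rels) ^ 2 ^ m * PresentedGroup.of 0 = 1 := by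
      have : PresentedGroup.mk rels (((FreeGroup.of 2) ^ (2 ^ m) *
          (FreeGroup.of 0) ^ (2 ^ 0)) ^ (2 ^ 0)) = 1 :=
        PresentedGroup.one_of_mem (by simp [hrels])
      simpa [PresentedGroup.of] using this
    have hy : (PresentedGroup.of 1 : PresentedGroup rels) = 1 := by
      have : PresentedGroup.mk rels ((FreeGroup.of 1) ^ (2 ^ 0)) = 1 :=
        PresentedGroup.one_of_mem (by simp [hrels])
      simpa [PresentedGroup.of] using this
    have htop : Subgroup.zpowers
        (Abelianization.of (PresentedGroup.of (2 : Fin 3) : PresentedGroup rels)) = ⊤ := by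
      refine abelianization_presentedGroup_eq_top fun i => ?_
      fin_cases i
      · change Abelianization.of (PresentedGroup.of 0) ∈ _
        rw [eq_inv_of_mul_eq_one_right hxγ, map_inv, map_pow]
        exact inv_mem (pow_mem (Subgroup.mem_zpowers _) _)
      · change Abelianization.of (PresentedGroup.of 1) ∈ _
        rw [hy, map_one]
        exact one_mem _
      · exact Subgroup.mem_zpowers _
    let v : Fin 3 → Multiplicative ℤ := ![(.ofAdd 1 ^ 2 ^ m)⁻¹, 1, .ofAdd 1]
    have hrel : ∀ r ∈ rels, FreeGroup.lift v r = 1 := by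
      rw [hrels]
      rintro r (rfl | rfl | rfl) <;> simp [v]
    refine ⟨nonempty_mulEquiv_int_of_zpowers_eq_top htop
      (Abelianization.lift (PresentedGroup.toGroup hrel)) ?_, htop⟩
    rw [Abelianization.lift_apply_of, PresentedGroup.toGroup.of]
    rfl
end

section
/- Let m, l, k₀, k₁, k₂ be non-negative integers and let G be the presented group ⟨x, y, γ ∣ (γ^(2^m) y^(2^l))^(2^k₀), x^(2^k₁), (x y x y⁻¹)^(2^k₂)⟩. Then the abelianization of G is an infinite cyclic group generated by the image of γ if and only if k₀ = k₁ = l = 0. -/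
/-- If the class of the generator `a` generates the abelianization, then any assignment of the
generators in a commutative group that respects the relators and kills `a` is trivial. -/
theorem PresentedGroup.eq_one_of_zpowers_abelianization_eq_top {α A : Type*} [CommGroup A]
    {rels : Set (FreeGroup α)} {a : α}
    (htop : Subgroup.zpowers (Abelianization.of (PresentedGroup.of a : PresentedGroup rels)) = ⊤)
    (f : α → A) (hf : ∀ r ∈ rels, FreeGroup.lift f r = 1) (ha : f a = 1) (b : α) :
    f b = 1 := by
  have hb : Abelianization.of (PresentedGroup.of b : PresentedGroup rels) ∈
      Subgroup.zpowers (Abelianization.of (PresentedGroup.of a : PresentedGroup rels)) :=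
    htop ▸ Subgroup.mem_top _
  obtain ⟨n, hn⟩ := Subgroup.mem_zpowers_iff.mp hb
  have h := congrArg (Abelianization.lift (PresentedGroup.toGroup hf)) hn
  simpa [ha] using h.symm

/-- A generator of the abelianization of a presented group is detected on the generators. -/
theorem PresentedGroup.zpowers_abelianization_eq_top {α : Type*} {rels : Set (FreeGroup α)}
    {a : α} (h : ∀ b, Abelianization.of (PresentedGroup.of b : PresentedGroup rels) ∈
      Subgroup.zpowers (Abelianization.of (PresentedGroup.of a : PresentedGroup rels))) :
    Subgroup.zpowers (Abelianization.of (PresentedGroup.of a : PresentedGroup rels)) = ⊤ := by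
  set H := Subgroup.zpowers (Abelianization.of (PresentedGroup.of a : PresentedGroup rels))
  have hcomap : (⊤ : Subgroup (PresentedGroup rels)) ≤ H.comap Abelianization.of := by
    rw [← PresentedGroup.closure_range_of, Subgroup.closure_le]
    rintro _ ⟨b, rfl⟩
    exact h b
  refine eq_top_iff.mpr fun z _ => ?_
  obtain ⟨g, rfl⟩ := QuotientGroup.mk_surjective z
  exact hcomap (Subgroup.mem_top g)

/-- A group generated by `g` with a homomorphism to `ℤ` sending `g` to `1` is infinite cyclic. -/
theorem nonempty_mulEquiv_int_of_zpowers_eq_top_s12 {G : Type*} [Group G] {g : G}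
    (htop : Subgroup.zpowers g = ⊤) (φ : G →* Multiplicative ℤ)
    (hφ : φ g = Multiplicative.ofAdd 1) : Nonempty (G ≃* Multiplicative ℤ) := by
  have hpow (n : ℤ) : φ (g ^ n) = Multiplicative.ofAdd n := by
    rw [map_zpow, hφ, ← ofAdd_zsmul, smul_eq_mul, mul_one]
  refine ⟨MulEquiv.ofBijective φ ⟨?_, fun n => ⟨g ^ n.toAdd, hpow _⟩⟩⟩
  refine (injective_iff_map_eq_one φ).mpr fun z hz => ?_
  have hzmem : z ∈ Subgroup.zpowers g := htop ▸ Subgroup.mem_top z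
  obtain ⟨n, rfl⟩ := Subgroup.mem_zpowers_iff.mp hzmem
  rw [hpow, ofAdd_eq_one] at hz
  rw [hz, zpow_zero]

/-- Positive powers of two annihilate the cyclic group of order two. -/
theorem pow_two_pow_eq_one_zmod_two (a : Multiplicative (ZMod 2)) {k : ℕ} (hk : k ≠ 0) :
    a ^ 2 ^ k = 1 := by
  obtain ⟨j, rfl⟩ := Nat.exists_eq_succ_of_ne_zero hk
  have ha : a ^ 2 = 1 := by revert a; decide
  rw [pow_succ', pow_mul, ha, one_pow]


/-- Lemma 6.3(4), homological computation: the abelianization of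
⟨x, y, γ ∣ (γ^(2^m) y^(2^l))^(2^k₀), x^(2^k₁), (x y x y⁻¹)^(2^k₂)⟩ is infinite
cyclic generated by the image of γ iff k₀ = k₁ = l = 0.  (x = 0, y = 1, γ = 2.) -/
theorem stmt12 (m l k₀ k₁ k₂ : ℕ) :
    ∀ (rels : Set (FreeGroup (Fin 3))),
      rels = {((FreeGroup.of 2) ^ (2 ^ m) * (FreeGroup.of 1) ^ (2 ^ l)) ^ (2 ^ k₀),
               (FreeGroup.of 0) ^ (2 ^ k₁),
               (FreeGroup.of 0 * FreeGroup.of 1 * FreeGroup.of 0 * (FreeGroup.of 1)⁻¹) ^ (2 ^ k₂)} →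
      ((Nonempty (Abelianization (PresentedGroup rels) ≃* Multiplicative ℤ) ∧
        Subgroup.zpowers (Abelianization.of (PresentedGroup.of ((2 : Fin 3)) : PresentedGroup rels)) = ⊤) ↔
        (k₀ = 0 ∧ k₁ = 0 ∧ l = 0)) := by
  rintro rels rfl
  have hne : (Multiplicative.ofAdd 1 : Multiplicative (ZMod 2)) ≠ 1 := by decide
  have hsq : (Multiplicative.ofAdd 1 * Multiplicative.ofAdd 1 : Multiplicative (ZMod 2)) = 1 := by
    decide
  constructor
  · rintro ⟨-, htop⟩
    refine ⟨?_, ?_, ?_⟩ <;> by_contra hk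
    · refine hne (PresentedGroup.eq_one_of_zpowers_abelianization_eq_top
        (A := Multiplicative (ZMod 2)) htop
        ![1, Multiplicative.ofAdd 1, 1] ?_ rfl 1)
      rintro r (rfl | rfl | rfl)
      · rw [map_pow, pow_two_pow_eq_one_zmod_two _ hk]
      · simp
      · simp
    · refine hne (PresentedGroup.eq_one_of_zpowers_abelianization_eq_top
        (A := Multiplicative (ZMod 2)) htop
        ![Multiplicative.ofAdd 1, 1, 1] ?_ rfl 0)
      rintro r (rfl | rfl | rfl)
      · simp
      · rw [map_pow, pow_two_pow_eq_one_zmod_two _ hk]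
      · simp [hsq]
    · refine hne (PresentedGroup.eq_one_of_zpowers_abelianization_eq_top
        (A := Multiplicative (ZMod 2)) htop
        ![1, Multiplicative.ofAdd 1, 1] ?_ rfl 1)
      rintro r (rfl | rfl | rfl)
      · simp [pow_two_pow_eq_one_zmod_two _ hk]
      · simp
      · simp
  · rintro ⟨rfl, rfl, rfl⟩
    set rels : Set (FreeGroup (Fin 3)) := _
    change Nonempty (Abelianization (PresentedGroup rels) ≃* _) ∧ _
    have hx : (PresentedGroup.of 0 : PresentedGroup rels) = 1 := by
      have h := PresentedGroup.one_of_mem (rels := rels) (Or.inr (Or.inl rfl))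
      rw [pow_zero, pow_one] at h
      exact h
    have hy : (PresentedGroup.of 1 : PresentedGroup rels) =
        (PresentedGroup.of 2 ^ 2 ^ m)⁻¹ := by
      have h := PresentedGroup.one_of_mem (rels := rels) (Or.inl rfl)
      simp only [pow_zero, pow_one, map_mul, map_pow] at h
      exact eq_inv_of_mul_eq_one_right h
    have htop : Subgroup.zpowers
        (Abelianization.of (PresentedGroup.of 2 : PresentedGroup rels)) = ⊤ := by
      refine PresentedGroup.zpowers_abelianization_eq_top fun b => ?_
      have hγ := Subgroup.mem_zpowers
        (Abelianization.of (PresentedGroup.of 2 : PresentedGroup rels))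
      fin_cases b
      · simp [hx, one_mem]
      · simp [hy]
      · exact hγ
    have hf : ∀ r ∈ rels, FreeGroup.lift
        ![1, (Multiplicative.ofAdd (1 : ℤ) ^ 2 ^ m)⁻¹, Multiplicative.ofAdd 1] r = 1 := by
      rintro r (rfl | rfl | rfl) <;> simp
    exact ⟨nonempty_mulEquiv_int_of_zpowers_eq_top_s12 htop
      (Abelianization.lift (PresentedGroup.toGroup hf)) (by simp), htop⟩
end
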